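/- arXiv:1711.05991 — 5 statements merged into one kernel-verified Lean document; each statement's English description precedes it below -/
import Mathlib

section
/- (Bryant's criterion in characteristic p) Let p be a prime, n ≥ 1 and k ≥ 2 integers, and let f be an 𝔽_p-linear combination of monomials X_{i_1}·X_{i_2}·⋯·X_{i_k} of length exactly k in the free associative algebra 𝔽_p⟨X_1, …, X_n⟩. Let E ⊆ M_k(𝔽_p) be the 𝔽_p-span of the cyclic matrix units e_{1,2}, e_{2,3}, …, e_{k−1,k}, e_{k,1}. Suppose that for every family C_1, …, C_n of elements of E, the trace of f(C_1, …, C_n) (the image of f under the algebra homomorphism sending X_i to C_i) is zero. Then f lies in the 𝔽_p-subspace of the free algebra spanned by all commutators u·v − v·u together with all p-th powers u^p. -/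
open scoped Fin.NatCast Fin.CommRing in
theorem bcp_prod {R : Type*} [CommRing R] {K n : ℕ} (v : Fin (K+1) → Fin n) (L : List (Fin n))
    (a b : Fin (K+1)) :
    (L.map (fun i => (Matrix.of fun a b : Fin (K+1) => if b = a + 1 ∧ v a = i then (1:R) else 0))).prod a b
      = if b = a + (L.length : Fin (K+1)) ∧ ∀ (j : ℕ) (h : j < L.length), L[j] = v (a + (j : Fin (K+1)))
        then 1 else 0 := by
  induction L generalizing a with
  | nil => simp [Matrix.one_apply, eq_comm]
  | cons x L ih =>
    rw [List.map_cons, List.prod_cons, Matrix.mul_apply, Finset.sum_eq_single (a+1)]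
    · rw [ih]
      simp only [Matrix.of_apply, true_and, List.length_cons, Nat.cast_add, Nat.cast_one]
      have : (∀ (j : ℕ) (h : j < L.length + 1), (x :: L)[j] = v (a + (j : Fin (K+1)))) ↔
          (v a = x ∧ ∀ (j : ℕ) (h : j < L.length), L[j] = v (a + 1 + (j : Fin (K+1)))) := by
        constructor
        · intro H
          refine ⟨by simpa using (H 0 (by omega)).symm, fun j h => ?_⟩
          have := H (j+1) (by omega)
          rw [List.getElem_cons_succ] at this
          rw [this]; congr 1; push_cast; ring
        · rintro ⟨h0, H⟩ j h
          cases j with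
          | zero => simp [h0]
          | succ j =>
            rw [List.getElem_cons_succ, H j (by omega)]; congr 1; push_cast; ring
      simp only [this]
      have e : a + 1 + (L.length : Fin (K+1)) = a + ((L.length : Fin (K+1)) + 1) := by ring
      rw [e]
      by_cases h1 : v a = x <;> simp [h1]
    · intro c _ hc
      simp [hc]
    · simp

open scoped Fin.NatCast Fin.CommRing in
theorem bcp_trace {p K n : ℕ} (v w : Fin (K+1) → Fin n) :
    Matrix.trace (FreeAlgebra.lift (ZMod p)
      (fun i => (Matrix.of fun a b : Fin (K+1) => if b = a + 1 ∧ v a = i then (1:ZMod p) else 0))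
      (List.ofFn fun i => FreeAlgebra.ι (ZMod p) (w i)).prod)
      = ∑ a : Fin (K+1), if w = (fun j => v (j + a)) then 1 else 0 := by
  rw [map_list_prod, List.map_ofFn]
  have : (List.ofFn ((FreeAlgebra.lift (ZMod p)
      (fun i => (Matrix.of fun a b : Fin (K+1) => if b = a + 1 ∧ v a = i then (1:ZMod p) else 0))) ∘
      fun i => FreeAlgebra.ι (ZMod p) (w i))) = (List.ofFn w).map
      (fun i => (Matrix.of fun a b : Fin (K+1) => if b = a + 1 ∧ v a = i then (1:ZMod p) else 0)) := by
    rw [List.map_ofFn]; congr 1; ext1 i; simp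
  rw [this, Matrix.trace]
  refine Finset.sum_congr rfl fun a _ => ?_
  rw [Matrix.diag_apply, bcp_prod]
  congr 1
  apply propext
  simp only [List.length_ofFn, List.getElem_ofFn]
  constructor
  · rintro ⟨-, H⟩
    ext1 j
    rw [H j j.2, Fin.cast_val_eq_self, add_comm a j]
  · intro H
    refine ⟨by simp, fun j h => ?_⟩
    have e : (⟨j, h⟩ : Fin (K+1)) = (j : Fin (K+1)) := by
      ext; simp [Fin.val_natCast, Nat.mod_eq_of_lt h]
    rw [H]
    dsimp only
    rw [e, add_comm a]

theorem bcp_rot {p K n : ℕ} {S : Submodule (ZMod p) (FreeAlgebra (ZMod p) (Fin n))}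
    (hS : ∀ u v, u * v - v * u ∈ S) (v : Fin (K+1) → Fin n) (a : Fin (K+1)) :
    (List.ofFn fun i => FreeAlgebra.ι (ZMod p) (v (i + a))).prod -
    (List.ofFn fun i => FreeAlgebra.ι (ZMod p) (v i)).prod ∈ S := by
  have h1 : ∀ v : Fin (K+1) → Fin n,
    (List.ofFn fun i => FreeAlgebra.ι (ZMod p) (v (i + 1))).prod -
    (List.ofFn fun i => FreeAlgebra.ι (ZMod p) (v i)).prod ∈ S := by
    intro v
    rw [List.ofFn_succ', List.ofFn_succ (f := fun i => FreeAlgebra.ι (ZMod p) (v i))]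
    simp only [List.concat_eq_append, List.prod_append, List.prod_cons, List.prod_nil, mul_one,
      Fin.coeSucc_eq_succ, Fin.last_add_one]
    exact hS _ _
  induction a using Fin.induction generalizing v with
  | zero => simp
  | succ a ih =>
    have h2 := ih (fun i => v (i + 1))
    have h3 := S.add_mem h2 (h1 v)
    rw [sub_add_sub_cancel] at h3
    have e : ∀ i : Fin (K+1), i + a.succ = i + a.castSucc + 1 := by
      intro i; rw [← Fin.coeSucc_eq_succ, add_assoc]
    simp only [e]
    exact h3

open scoped Fin.NatCast Fin.CommRing in
theorem bcp_pow {p K n : ℕ} (hp : p.Prime) (v : Fin (K+1) → Fin n)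
    (hd : p ∣ (Finset.univ.filter fun a : Fin (K+1) => (fun j => v (j + a)) = v).card) :
    ∃ u : FreeAlgebra (ZMod p) (Fin n),
    (List.ofFn fun i => FreeAlgebra.ι (ZMod p) (v i)).prod = u ^ p := by
  have := Fact.mk hp
  let H : AddSubgroup (Fin (K+1)) :=
    { carrier := {a | ∀ j, v (j + a) = v j}
      zero_mem' := by simp
      add_mem' := by
        intro a b ha hb j
        rw [← add_assoc, hb, ha]
      neg_mem' := by
        intro a ha j
        have := ha (j + -a)
        rw [← this]; congr 1; ring }
  have hH : ∀ a, a ∈ H ↔ ∀ j, v (j + a) = v j := fun a => Iff.rfl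
  have hc : Nat.card H = (Finset.univ.filter fun a : Fin (K+1) => (fun j => v (j + a)) = v).card := by
    rw [← Nat.card_eq_finsetCard]
    refine Nat.card_congr (Equiv.subtypeEquivRight fun a => ?_)
    simp [hH, funext_iff]
  rw [← hc] at hd
  obtain ⟨g, hg⟩ := exists_prime_addOrderOf_dvd_card' p hd
  have hk : p ∣ K + 1 := by
    have := H.card_addSubgroup_dvd_card
    simp at this
    exact hd.trans (by simpa using this)
  obtain ⟨m, hm⟩ := hk
  have hgo : addOrderOf (g : Fin (K+1)) = p := by simpa using hg
  have hmH : (m : Fin (K+1)) ∈ H := by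
    have h0 : p • (g : Fin (K+1)) = 0 := by rw [← hgo]; exact addOrderOf_nsmul_eq_zero _
    have hmb : m ∣ (g : Fin (K+1)).val := by
      have : ((p * (g : Fin (K+1)).val : ℕ) : Fin (K+1)) = 0 := by
        rw [Nat.cast_mul, Fin.cast_val_eq_self, ← nsmul_eq_mul]; exact h0
      rw [Fin.natCast_eq_zero] at this
      obtain ⟨q, hq⟩ := this
      refine ⟨q, Nat.eq_of_mul_eq_mul_left hp.pos ?_⟩
      rw [hq, ← mul_assoc, ← hm]
    obtain ⟨b, hb⟩ := hmb
    have hpb : ¬ p ∣ b := by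
      rintro ⟨c, rfl⟩
      have : (g : Fin (K+1)) = 0 := by
        rw [← Fin.cast_val_eq_self (g : Fin (K+1)), Fin.natCast_eq_zero, hb, hm]
        exact ⟨c, by ring⟩
      rw [this, addOrderOf_zero] at hgo
      exact hp.one_lt.ne hgo
    have hcop : Nat.Coprime b p := ((Nat.Prime.coprime_iff_not_dvd hp).2 hpb).symm
    obtain ⟨c, -, hc⟩ := Nat.exists_mul_mod_eq_one_of_coprime hcop hp.one_lt
    have : (m : Fin (K+1)) = c • (g : Fin (K+1)) := by
      rw [← Fin.cast_val_eq_self (g : Fin (K+1)), hb, nsmul_eq_mul, ← Nat.cast_mul]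
      have e : c * (m * b) = m + (K+1) * (b * c / p) := by
        have := Nat.div_add_mod (b * c) p
        rw [hc] at this
        calc c * (m * b) = m * (b * c) := by ring
          _ = m * (p * (b * c / p) + 1) := by rw [this]
          _ = m + (p * m) * (b * c / p) := by ring
          _ = _ := by rw [hm]
      rw [e, Nat.cast_add, Nat.cast_mul, (Fin.natCast_eq_zero).2 (dvd_refl (K+1))]
      simp
    rw [this]
    exact H.nsmul_mem g.2 c
  have hper : ∀ i : ℕ, ∀ j : Fin (K+1), v (j + (i * m : ℕ)) = v j := by
    intro i
    have : ((i * m : ℕ) : Fin (K+1)) ∈ H := by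
      rw [Nat.cast_mul, ← nsmul_eq_mul]; exact H.nsmul_mem hmH i
    exact this
  have hv : ∀ i : Fin (p * m), v (Fin.cast hm.symm i) = v ((i : ℕ) : Fin (K+1)) := by
    intro i; congr 1; ext; simp [Fin.val_natCast]
    rw [Nat.mod_eq_of_lt]; rw [hm]; exact i.2
  refine ⟨(List.ofFn fun j : Fin m => FreeAlgebra.ι (ZMod p) (v ((j : ℕ) : Fin (K+1)))).prod, ?_⟩
  rw [List.ofFn_congr hm, List.ofFn_mul, List.prod_flatten, List.map_ofFn]
  simp only [hv]
  have : (List.prod ∘ fun i : Fin p => List.ofFn fun j : Fin m =>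
      FreeAlgebra.ι (ZMod p) (v (((i : ℕ) * m + (j : ℕ) : ℕ) : Fin (K+1)))) = fun _ =>
      (List.ofFn fun j : Fin m => FreeAlgebra.ι (ZMod p) (v ((j : ℕ) : Fin (K+1)))).prod := by
    funext i
    simp only [Function.comp]
    congr 2; funext j
    rw [add_comm ((i : ℕ) * m), Nat.cast_add, hper]
  rw [this, List.ofFn_const, List.prod_replicate]

theorem bcp_main {p K n : ℕ} (hp : p.Prime)
    {S : Submodule (ZMod p) (FreeAlgebra (ZMod p) (Fin n))}
    (hS : ∀ u v, u * v - v * u ∈ S) (hS' : ∀ u, u ^ p ∈ S)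
    (c : (Fin (K+1) → Fin n) → ZMod p)
    (hc : ∀ v : Fin (K+1) → Fin n, ∑ a : Fin (K+1), c (fun j => v (j + a)) = 0) :
    ∑ w, c w • (List.ofFn fun i => FreeAlgebra.ι (ZMod p) (w i)).prod ∈ S := by
  classical
  have := Fact.mk hp
  let s : Setoid (Fin (K+1) → Fin n) :=
    { r := fun v w => ∃ a, w = fun j => v (j + a)
      iseqv :=
        { refl := fun v => ⟨0, by simp⟩
          symm := by
            rintro v w ⟨a, rfl⟩
            exact ⟨-a, by simp [add_assoc]⟩
          trans := by
            rintro v w x ⟨a, rfl⟩ ⟨b, rfl⟩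
            exact ⟨b + a, by simp [add_assoc]⟩ } }
  rw [← Finset.sum_fiberwise (s := Finset.univ) (g := fun w => (Quotient.mk s w))]
  refine S.sum_mem fun o _ => ?_
  obtain ⟨v, rfl⟩ := Quotient.exists_rep o
  have hmem : ∀ w, w ∈ (Finset.univ.filter fun w => Quotient.mk s w = Quotient.mk s v) ↔
      ∃ a, w = fun j => v (j + a) := by
    intro w
    simp only [Finset.mem_filter, Finset.mem_univ, true_and]
    rw [eq_comm, Quotient.eq]; rfl
  set F := (Finset.univ.filter fun w => Quotient.mk s w = Quotient.mk s v) with hF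
  have hrot : ∀ w ∈ F, (List.ofFn fun i => FreeAlgebra.ι (ZMod p) (w i)).prod -
      (List.ofFn fun i => FreeAlgebra.ι (ZMod p) (v i)).prod ∈ S := by
    intro w hw
    obtain ⟨a, rfl⟩ := (hmem w).1 hw
    exact bcp_rot hS v a
  have hsuff : (∑ w ∈ F, c w) • (List.ofFn fun i => FreeAlgebra.ι (ZMod p) (v i)).prod ∈ S := by
    by_cases hd : p ∣ (Finset.univ.filter fun a : Fin (K+1) => (fun j => v (j + a)) = v).card
    · obtain ⟨u, hu⟩ := bcp_pow hp v hd
      rw [hu]; exact S.smul_mem _ (hS' u)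
    · have h := hc v
      rw [← Finset.sum_fiberwise_of_maps_to (t := F) (g := fun a => fun j => v (j + a))
        (fun a _ => (hmem _).2 ⟨a, rfl⟩)] at h
      have h2 : ∀ w ∈ F, ∑ a ∈ Finset.univ.filter (fun a : Fin (K+1) => (fun j => v (j + a)) = w),
          c (fun j => v (j + a)) =
          ((Finset.univ.filter fun a : Fin (K+1) => (fun j => v (j + a)) = v).card : ZMod p) * c w := by
        intro w hw
        obtain ⟨b, rfl⟩ := (hmem w).1 hw
        rw [Finset.sum_congr rfl (g := fun _ => c (fun j => v (j + b)))
          (fun a ha => by rw [(Finset.mem_filter.1 ha).2]), Finset.sum_const, nsmul_eq_mul]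
        congr 2
        refine Finset.card_bij (fun a _ => a - b) ?_ ?_ ?_
        · intro a ha
          simp only [Finset.mem_filter, Finset.mem_univ, true_and] at ha ⊢
          funext j
          have := congrFun ha (j - b)
          simp only [sub_add_cancel] at this
          rw [← this]; congr 1; abel
        · intro a _ a' _ h; simpa using h
        · intro a ha
          simp only [Finset.mem_filter, Finset.mem_univ, true_and] at ha
          refine ⟨a + b, ?_, by simp⟩
          simp only [Finset.mem_filter, Finset.mem_univ, true_and]
          funext j
          have := congrFun ha (j + b)
          rw [← this]; congr 1; abel
      rw [Finset.sum_congr rfl h2, ← Finset.mul_sum] at h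
      rcases mul_eq_zero.1 h with h | h
      · exact absurd ((ZMod.natCast_eq_zero_iff _ _).1 h) hd
      · rw [h, zero_smul]; exact S.zero_mem
  have : ∑ w ∈ F, c w • (List.ofFn fun i => FreeAlgebra.ι (ZMod p) (w i)).prod =
      ∑ w ∈ F, c w • ((List.ofFn fun i => FreeAlgebra.ι (ZMod p) (w i)).prod -
      (List.ofFn fun i => FreeAlgebra.ι (ZMod p) (v i)).prod) +
      (∑ w ∈ F, c w) • (List.ofFn fun i => FreeAlgebra.ι (ZMod p) (v i)).prod := by
    rw [Finset.sum_smul, ← Finset.sum_add_distrib]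
    refine Finset.sum_congr rfl fun w _ => ?_
    rw [← smul_add, sub_add_cancel]
  rw [this]
  exact S.add_mem (S.sum_mem fun w hw => S.smul_mem _ (hrot w hw)) hsuff

/-- **Bryant's criterion in characteristic `p`.** Let `p` be prime and
`f ∈ 𝔽_p⟨X_1,…,X_n⟩` an `𝔽_p`-linear combination of monomials of length exactly `k`
(`k ≥ 2`).  Let `E ⊆ M_k(𝔽_p)` be the `𝔽_p`-span of the cyclic matrix units
`e_{1,2}, …, e_{k-1,k}, e_{k,1}`.  If `tr (f(C_1,…,C_n)) = 0` for all `C_1,…,C_n ∈ E`,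
then `f` lies in the `𝔽_p`-subspace spanned by commutators `uv - vu` and `p`-th powers
`u^p`. -/
theorem bryant_criterion_char_p (p n k : ℕ) (hp : p.Prime) (hn : 1 ≤ n) (hk : 2 ≤ k)
    (f : FreeAlgebra (ZMod p) (Fin n))
    (hf : f ∈ Submodule.span (ZMod p)
      {x : FreeAlgebra (ZMod p) (Fin n) | ∃ w : Fin k → Fin n,
        x = (List.ofFn fun i => FreeAlgebra.ι (ZMod p) (w i)).prod})
    (htr : ∀ C : Fin n → Matrix (Fin k) (Fin k) (ZMod p),
      (∀ i, C i ∈ Submodule.span (ZMod p)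
          {M : Matrix (Fin k) (Fin k) (ZMod p) |
            ∃ a : Fin k, M = Matrix.single a (finRotate k a) 1}) →
      Matrix.trace (FreeAlgebra.lift (ZMod p) C f) = 0) :
    f ∈ Submodule.span (ZMod p)
      {x : FreeAlgebra (ZMod p) (Fin n) |
        (∃ u v : FreeAlgebra (ZMod p) (Fin n), x = u * v - v * u) ∨
        (∃ u : FreeAlgebra (ZMod p) (Fin n), x = u ^ p)} := by
  obtain ⟨K, rfl⟩ : ∃ K, k = K + 1 := ⟨k - 1, by omega⟩
  have hset : {x : FreeAlgebra (ZMod p) (Fin n) | ∃ w : Fin (K+1) → Fin n,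
        x = (List.ofFn fun i => FreeAlgebra.ι (ZMod p) (w i)).prod} =
      Set.range (fun w : Fin (K+1) → Fin n =>
        (List.ofFn fun i => FreeAlgebra.ι (ZMod p) (w i)).prod) := by
    ext x; simp [eq_comm]
  rw [hset, Submodule.mem_span_range_iff_exists_fun] at hf
  obtain ⟨c, rfl⟩ := hf
  refine bcp_main hp (fun u v => Submodule.subset_span (Or.inl ⟨u, v, rfl⟩))
    (fun u => Submodule.subset_span (Or.inr ⟨u, rfl⟩)) c fun v => ?_
  have h := htr (fun i => (Matrix.of fun a b : Fin (K+1) =>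
    if b = a + 1 ∧ v a = i then (1:ZMod p) else 0)) ?_
  · rw [map_sum, Matrix.trace_sum] at h
    simp only [map_smul, Matrix.trace_smul, bcp_trace, smul_eq_mul, Finset.mul_sum] at h
    rw [Finset.sum_comm] at h
    simpa using h
  · intro i
    have : (Matrix.of fun a b : Fin (K+1) => if b = a + 1 ∧ v a = i then (1:ZMod p) else 0) =
        ∑ a : Fin (K+1), (if v a = i then (1:ZMod p) else 0) •
          Matrix.single a (finRotate (K+1) a) (1 : ZMod p) := by
      ext x y
      rw [Matrix.sum_apply, Finset.sum_eq_single x]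
      · by_cases h1 : v x = i <;> simp [h1, Matrix.single_apply, eq_comm (a := y)]
      · intro b _ hb
        simp [Matrix.single_apply, hb]
      · simp
    rw [this]
    exact Submodule.sum_mem _ fun a _ => Submodule.smul_mem _ _ (Submodule.subset_span ⟨a, rfl⟩)
end

section
/- Let G be a group, j ≥ 1 an integer, and σ an automorphism of G such that σ(g)·g⁻¹ ∈ Γ_{j+1}(G) for every g ∈ G. Then for every i ≥ 1 and every g ∈ Γ_i(G), one has σ(g)·g⁻¹ ∈ Γ_{i+j}(G); that is, an automorphism acting trivially on G/Γ_{j+1}(G) acts trivially on every quotient Γ_i(G)/Γ_{i+j}(G). -/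
theorem three_sub_aux {G : Type*} [Group G] (A B C N : Subgroup G) [N.Normal]
    (h1 : ⁅⁅B, C⁆, A⁆ ≤ N) (h2 : ⁅⁅C, A⁆, B⁆ ≤ N) : ⁅⁅A, B⁆, C⁆ ≤ N := by
  have key : ∀ X : Subgroup G, X ≤ N ↔ X.map (QuotientGroup.mk' N) = ⊥ := by
    intro X
    rw [Subgroup.map_eq_bot_iff, QuotientGroup.ker_mk']
  rw [key] at h1 h2 ⊢
  simp only [Subgroup.map_commutator] at h1 h2 ⊢
  exact Subgroup.commutator_commutator_eq_bot_of_rotate h1 h2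

theorem lcs_comm_aux {G : Type*} [Group G] (m : ℕ) : ∀ n : ℕ,
    ⁅Subgroup.lowerCentralSeries (⊤ : Subgroup G) m,
      Subgroup.lowerCentralSeries (⊤ : Subgroup G) n⁆ ≤
      Subgroup.lowerCentralSeries (⊤ : Subgroup G) (m + n + 1) := by
  induction m with
  | zero =>
    intro n
    rw [Subgroup.commutator_comm, Nat.zero_add]
    exact le_rfl
  | succ m ih =>
    intro n
    rw [Subgroup.lowerCentralSeries_succ ⊤ m]
    apply three_sub_aux
    · rw [Subgroup.commutator_comm ⊤, Subgroup.commutator_comm _ (Subgroup.lowerCentralSeries ⊤ m),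
        show m + 1 + n + 1 = m + (n + 1) + 1 by ring]
      exact ih (n + 1)
    · rw [Subgroup.commutator_comm (Subgroup.lowerCentralSeries ⊤ n),
        show m + 1 + n + 1 = (m + n + 1) + 1 by ring]
      exact Subgroup.commutator_mono (ih n) le_rfl

open scoped commutatorElement in
theorem aut_aux {G : Type*} [Group G] (j : ℕ)
    (σ : MulAut G) (hσ : ∀ g : G, σ g * g⁻¹ ∈ Subgroup.lowerCentralSeries (⊤ : Subgroup G) j)
    (n : ℕ) : ∀ g ∈ Subgroup.lowerCentralSeries (⊤ : Subgroup G) n,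
      σ g * g⁻¹ ∈ Subgroup.lowerCentralSeries (⊤ : Subgroup G) (n + j) := by
  induction n with
  | zero => intro g _; simpa using hσ g
  | succ n ih =>
    let N := Subgroup.lowerCentralSeries (⊤ : Subgroup G) (n + 1 + j)
    let q : G →* G ⧸ N := QuotientGroup.mk' N
    have hq : ∀ x, x ∈ N ↔ q x = 1 := fun x => (QuotientGroup.eq_one_iff x).symm
    have hle : Subgroup.lowerCentralSeries (⊤ : Subgroup G) (n + 1) ≤
        (q.comp σ.toMonoidHom).eqLocus q := by
      rw [Subgroup.lowerCentralSeries_succ, Subgroup.commutator_le]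
      intro a ha b _
      change q (σ ⁅a, b⁆) = q ⁅a, b⁆
      obtain ⟨u, hu, hua⟩ : ∃ u ∈ Subgroup.lowerCentralSeries (⊤ : Subgroup G) (n + j),
        σ a = u * a := ⟨σ a * a⁻¹, ih a ha, by simp⟩
      obtain ⟨v, hv, hvb⟩ : ∃ v ∈ Subgroup.lowerCentralSeries (⊤ : Subgroup G) j,
        σ b = v * b := ⟨σ b * b⁻¹, hσ b, by simp⟩
      have hc : ∀ x y, ⁅x, y⁆ ∈ N → Commute (q x) (q y) := by
        intro x y h
        rw [hq, map_commutatorElement] at h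
        exact commutatorElement_eq_one_iff_commute.1 h
      have e : n + 1 + j = n + j + 1 := by ring
      have cu : ∀ y, Commute (q u) (q y) := fun y => hc _ _ (by
        change _ ∈ Subgroup.lowerCentralSeries ⊤ (n + 1 + j)
        rw [e]
        exact Subgroup.commutator_mem_commutator hu (Subgroup.mem_top y))
      have cv : Commute (q a) (q v) := hc _ _ (by
        change _ ∈ Subgroup.lowerCentralSeries ⊤ (n + 1 + j)
        rw [e]
        exact lcs_comm_aux n j (Subgroup.commutator_mem_commutator ha hv))
      have cw : Commute (q ⁅a, b⁆) (q v) := hc _ _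
        (Subgroup.lowerCentralSeries_antitone ⊤ (Nat.le_succ _)
          (lcs_comm_aux (n + 1) j (Subgroup.commutator_mem_commutator
            (Subgroup.commutator_mem_commutator ha (Subgroup.mem_top b)) hv)))
      have s1 : q ⁅u * a, v * b⁆ = q ⁅a, v * b⁆ := by
        rw [commutatorElement_def, mul_inv_rev, 
          show u * a * (v * b) * (a⁻¹ * u⁻¹) * (v * b)⁻¹
            = u * (a * (v * b) * a⁻¹) * u⁻¹ * (v * b)⁻¹ by group]
        rw [map_mul, map_mul, map_mul, (cu _).eq, map_inv q u, mul_inv_cancel_right, ← map_mul]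
        rfl
      have s2 : q ⁅a, v * b⁆ = q v * q ⁅a, b⁆ * (q v)⁻¹ := by
        simp only [commutatorElement_def, map_mul, map_inv, mul_inv_rev, ← mul_assoc, cv.eq]
      rw [map_commutatorElement, hua, hvb, s1, s2, ← cw.eq, mul_inv_cancel_right]
    intro g hg
    have h : q (σ g) = q g := hle hg
    exact (hq _).2 (by rw [map_mul, map_inv, h, mul_inv_cancel])


/-- An automorphism acting trivially on `G/Γ_{j+1}(G)` acts trivially on every quotient
`Γ_i(G)/Γ_{i+j}(G)`: if `σ(g)·g⁻¹ ∈ Γ_{j+1}(G)` for all `g ∈ G`, then for all `i ≥ 1` and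
`g ∈ Γ_i(G)` one has `σ(g)·g⁻¹ ∈ Γ_{i+j}(G)`.
(Recall `Γ_i(G) = lowerCentralSeries G (i-1)`.) -/
theorem aut_trivial_on_quotients {G : Type*} [Group G] (j : ℕ) (hj : 1 ≤ j)
    (σ : MulAut G) (hσ : ∀ g : G, σ g * g⁻¹ ∈ Subgroup.lowerCentralSeries (⊤ : Subgroup G) j) :
    ∀ i, 1 ≤ i → ∀ g ∈ Subgroup.lowerCentralSeries (⊤ : Subgroup G) (i - 1),
      σ g * g⁻¹ ∈ Subgroup.lowerCentralSeries (⊤ : Subgroup G) (i + j - 1) := by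

  intro i hi g hg
  obtain ⟨n, rfl⟩ : ∃ n, i = n + 1 := ⟨i - 1, by omega⟩
  rw [show n + 1 + j - 1 = n + j by omega]
  exact aut_aux j σ hσ n g hg
end

section
/- Let G be a group, ℤG its integral group ring with augmentation ideal I, and for i ≥ 1 let D_i(G) := {g ∈ G : g − 1 ∈ I^i} be the i-th dimension subgroup. Let φ be an automorphism of G, let φ̂ denote the induced ring automorphism of ℤG, and let j ≥ 1. Then the following are equivalent: (a) for every i ≥ 1 and every g ∈ D_i(G), one has φ(g)·g⁻¹ ∈ D_{i+j}(G); (b) for every i ≥ 1 and every u ∈ I^i, one has φ̂(u) − u ∈ I^{i+j}. -/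
/-- The augmentation ideal `I = ker ε` of the integral group ring `ℤG`, as a
`ℤ`-submodule of `MonoidAlgebra ℤ G`. -/
noncomputable def augIdeal (G : Type*) [Group G] : Submodule ℤ (MonoidAlgebra ℤ G) :=
  LinearMap.ker (MonoidAlgebra.lift ℤ ℤ G 1).toLinearMap

theorem mem_augIdeal_iff {G : Type*} [Group G] (x : MonoidAlgebra ℤ G) :
    x ∈ augIdeal G ↔ MonoidAlgebra.lift ℤ ℤ G 1 x = 0 := by
  simp [augIdeal]

theorem augIdeal_mul_left {G : Type*} [Group G] (x y : MonoidAlgebra ℤ G)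
    (hy : y ∈ augIdeal G) : x * y ∈ augIdeal G := by
  rw [mem_augIdeal_iff] at *
  rw [map_mul, hy, mul_zero]

theorem augIdeal_mul_right {G : Type*} [Group G] (x y : MonoidAlgebra ℤ G)
    (hx : x ∈ augIdeal G) : x * y ∈ augIdeal G := by
  rw [mem_augIdeal_iff] at *
  rw [map_mul, hx, zero_mul]

theorem augIdeal_pow_mul_right {G : Type*} [Group G] (n : ℕ) (x y : MonoidAlgebra ℤ G)
    (hx : x ∈ augIdeal G ^ (n + 1)) : x * y ∈ augIdeal G ^ (n + 1) := by
  rw [pow_succ] at *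
  induction hx using Submodule.mul_induction_on' with
  | mem_mul_mem a ha b hb =>
    rw [mul_assoc]
    exact Submodule.mul_mem_mul ha (augIdeal_mul_right b y hb)
  | add a _ b _ iha ihb =>
    rw [add_mul]
    exact add_mem iha ihb

theorem augIdeal_pow_le {G : Type*} [Group G] (n : ℕ) :
    augIdeal G ^ (n + 1) ≤ augIdeal G := by
  rw [pow_succ, Submodule.mul_le]
  intro a _ b hb
  exact augIdeal_mul_left a b hb

theorem augIdeal_le_span {G : Type*} [Group G] :
    augIdeal G ≤ Submodule.span ℤ (Set.range fun g : G => MonoidAlgebra.of ℤ G g - 1) := by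
  have key : ∀ x : MonoidAlgebra ℤ G,
      x - (MonoidAlgebra.lift ℤ ℤ G 1 x) • (1 : MonoidAlgebra ℤ G) ∈
        Submodule.span ℤ (Set.range fun g : G => MonoidAlgebra.of ℤ G g - 1) := by
    intro x
    induction x using MonoidAlgebra.induction_on with
    | of g =>
      apply Submodule.subset_span
      refine ⟨g, ?_⟩
      simp
    | add a b iha ihb =>
      have := add_mem iha ihb
      rw [map_add, add_smul]
      convert this using 1
      abel
    | smul r a iha =>
      have := Submodule.smul_mem _ r iha
      rw [map_smul, smul_assoc, ← smul_sub]
      exact this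
  intro x hx
  have h := key x
  rw [mem_augIdeal_iff] at hx
  rwa [hx, zero_smul, sub_zero] at h

/-- Let `φ` be an automorphism of `G`, `Φ` the induced ring automorphism of `ℤG`
(characterized by `Φ(g) = φ(g)` on group elements), and `j ≥ 1`.  Then `φ` moves each
dimension subgroup `D_i(G) = {g | g - 1 ∈ I^i}` trivially modulo `D_{i+j}(G)` if and only
if `Φ(u) - u ∈ I^{i+j}` for every `u ∈ I^i` and every `i ≥ 1`. -/
theorem dimension_filtration_eq_ideal_filtration {G : Type*} [Group G] (φ : MulAut G)
    (Φ : MonoidAlgebra ℤ G →+* MonoidAlgebra ℤ G)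
    (hΦ : ∀ g : G, Φ (MonoidAlgebra.of ℤ G g) = MonoidAlgebra.of ℤ G (φ g))
    (j : ℕ) (hj : 1 ≤ j) :
    (∀ i, 1 ≤ i → ∀ g : G,
        MonoidAlgebra.of ℤ G g - 1 ∈ (augIdeal G) ^ i →
        MonoidAlgebra.of ℤ G (φ g * g⁻¹) - 1 ∈ (augIdeal G) ^ (i + j)) ↔
      (∀ i, 1 ≤ i → ∀ u ∈ (augIdeal G) ^ i, Φ u - u ∈ (augIdeal G) ^ (i + j)) := by
  obtain ⟨k, rfl⟩ : ∃ k, j = k + 1 := ⟨j - 1, by omega⟩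
  constructor
  · intro h
    have base : ∀ u ∈ augIdeal G, Φ u - u ∈ augIdeal G ^ (1 + (k + 1)) := by
      intro u hu
      have hu' := augIdeal_le_span hu
      clear hu
      induction hu' using Submodule.span_induction with
      | mem x hx =>
        obtain ⟨g, rfl⟩ := hx
        have h1 := h 1 le_rfl g (by
          rw [pow_one, mem_augIdeal_iff]
          simp)
        rw [show 1 + (k + 1) = (k + 1) + 1 by omega] at h1 ⊢
        have h2 := augIdeal_pow_mul_right (k + 1) _ (MonoidAlgebra.of ℤ G g) h1
        rw [sub_mul, ← map_mul, inv_mul_cancel_right, one_mul] at h2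
        simpa only [map_sub, map_one, hΦ, sub_sub_sub_cancel_right] using h2
      | zero => simp
      | add a b _ _ iha ihb =>
        rw [map_add, add_sub_add_comm]
        exact add_mem iha ihb
      | smul r a _ iha =>
        rw [map_zsmul, ← smul_sub]
        exact Submodule.smul_mem _ r iha
    intro i hi
    induction i, hi using Nat.le_induction with
    | base =>
      intro u hu
      rw [pow_one] at hu
      exact base u hu
    | succ i hi ih =>
      intro u hu
      rw [pow_succ] at hu
      induction hu using Submodule.mul_induction_on' with
      | mem_mul_mem a ha b hb =>
        have hb1 := base b hb
        have hb2 : Φ b ∈ augIdeal G := by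
          rw [show 1 + (k + 1) = (k + 1) + 1 by omega] at hb1
          have := add_mem (augIdeal_pow_le _ hb1) hb
          rwa [sub_add_cancel] at this
        have e : Φ (a * b) - a * b = (Φ a - a) * Φ b + a * (Φ b - b) := by
          rw [map_mul]
          noncomm_ring
        rw [e]
        apply add_mem
        · rw [show i + 1 + (k + 1) = (i + (k + 1)) + 1 by omega, pow_succ]
          exact Submodule.mul_mem_mul (ih a ha) hb2
        · rw [show i + 1 + (k + 1) = i + (1 + (k + 1)) by omega, pow_add]
          exact Submodule.mul_mem_mul ha hb1
      | add a _ b _ iha ihb =>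
        rw [map_add, add_sub_add_comm]
        exact add_mem iha ihb
  · intro h i hi g hg
    have h1 := h i hi _ hg
    rw [← add_assoc] at h1 ⊢
    have h2 := augIdeal_pow_mul_right _ _ (MonoidAlgebra.of ℤ G g⁻¹) h1
    rw [map_sub, map_one, hΦ, sub_sub_sub_cancel_right, sub_mul, ← map_mul, ← map_mul,
      mul_inv_cancel, map_one] at h2
    exact h2
end

section
/- Let G be a group, ℤG its integral group ring with augmentation ε and augmentation ideal I. Let ∂ : ℤG → ℤG be a ℤ-linear map satisfying ∂(u·v) = ∂(u)·ε(v) + u·∂(v) for all u, v ∈ ℤG. If m ≥ 0 is such that ∂(ℤG) ⊆ I^m, then for every k ≥ 1 one has ∂(I^k) ⊆ I^{k+m−1}. In particular (m = 0), any such derivation satisfies ∂(I^k) ⊆ I^{k−1} for all k ≥ 1. -/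
/-- Powers of the augmentation ideal, with the convention `I^0 = ℤG`. -/
noncomputable def augIdealPow (G : Type*) [Group G] (k : ℕ) :
    Submodule ℤ (MonoidAlgebra ℤ G) :=
  if k = 0 then ⊤ else (augIdeal G) ^ k

/-- Let `∂ : ℤG → ℤG` be a `ℤ`-linear map with `∂(uv) = ∂(u)·ε(v) + u·∂(v)`.
If `∂(ℤG) ⊆ I^m` then `∂(I^k) ⊆ I^{k+m-1}` for every `k ≥ 1` (with `I^0 = ℤG`). -/
theorem derivation_degree {G : Type*} [Group G]
    (D : MonoidAlgebra ℤ G →ₗ[ℤ] MonoidAlgebra ℤ G)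
    (hD : ∀ u v : MonoidAlgebra ℤ G,
      D (u * v) = (MonoidAlgebra.lift ℤ ℤ G 1 v) • D u + u * D v)
    (m : ℕ) (hDm : ∀ u : MonoidAlgebra ℤ G, D u ∈ augIdealPow G m) :
    ∀ k, 1 ≤ k → ∀ u ∈ (augIdeal G) ^ k, D u ∈ augIdealPow G (k + m - 1) := by
  have hmul : ∀ (j : ℕ) (a b : MonoidAlgebra ℤ G), a ∈ augIdeal G → b ∈ augIdealPow G j →
      a * b ∈ augIdealPow G (j + 1) := by
    intro j a b ha hb
    unfold augIdealPow at hb ⊢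
    rw [if_neg (Nat.succ_ne_zero j)]
    by_cases hj : j = 0
    · subst hj
      rw [zero_add, pow_one]
      have ha' : MonoidAlgebra.lift ℤ ℤ G 1 a = 0 := ha
      change MonoidAlgebra.lift ℤ ℤ G 1 (a * b) = 0
      rw [map_mul, ha', zero_mul]
    · rw [if_neg hj] at hb
      rw [pow_succ']
      exact Submodule.mul_mem_mul ha hb
  have haug : ∀ k, 1 ≤ k → ∀ u ∈ (augIdeal G) ^ k, MonoidAlgebra.lift ℤ ℤ G 1 u = 0 := by
    intro k hk u hu
    obtain ⟨n, rfl⟩ : ∃ n, k = n + 1 := ⟨k - 1, by omega⟩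
    rw [pow_succ'] at hu
    refine Submodule.mul_induction_on hu ?_ ?_
    · intro a ha b _
      have ha' : MonoidAlgebra.lift ℤ ℤ G 1 a = 0 := ha
      rw [map_mul, ha', zero_mul]
    · intro x y hx hy
      rw [map_add, hx, hy, add_zero]
  intro k hk
  induction k, hk using Nat.le_induction with
  | base =>
    intro u _
    rw [Nat.add_sub_cancel_left]
    exact hDm u
  | succ k hk ih =>
    intro u hu
    rw [pow_succ'] at hu
    refine Submodule.mul_induction_on hu ?_ ?_
    · intro a ha b hb
      rw [hD, haug k hk b hb, zero_smul, zero_add]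
      have h := hmul _ a (D b) ha (ih b hb)
      rwa [show k + m - 1 + 1 = k + 1 + m - 1 by omega] at h
    · intro x y hx hy
      rw [map_add]
      exact add_mem hx hy
end

section
/- Let n ≥ 1 and c ≥ 1 be integers and F_n the free group on n generators. Let π : F_n/Γ_{c+1}(F_n) → F_n/Γ_c(F_n) be the canonical projection. Then for every automorphism φ of F_n/Γ_c(F_n) there exists an automorphism ψ of F_n/Γ_{c+1}(F_n) such that π ∘ ψ = φ ∘ π; that is, the canonical homomorphism Aut(F_n/Γ_{c+1}(F_n)) → Aut(F_n/Γ_c(F_n)) is surjective. -/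
/-- An endomorphism inducing the identity modulo a central subgroup contained in the
commutator subgroup is bijective. -/
theorem bijective_of_central_lift {G Q : Type*} [Group G] [Group Q] (π : G →* Q)
    (hZ : ∀ z, π z = 1 → ∀ x, x * z = z * x) (hC : π.ker ≤ commutator G)
    (h : G →* G) (hh : ∀ x, π (h x) = π x) : Function.Bijective h := by
  have key : ∀ x, π (x⁻¹ * h x) = 1 := fun x => by simp [hh]
  let d : G →* π.ker :=
    { toFun := fun x => ⟨x⁻¹ * h x, key x⟩
      map_one' := by simp
      map_mul' := fun x y => by
        apply Subtype.ext
        have := hZ _ (key x) y⁻¹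
        simp only [Subgroup.coe_mul, mul_inv_rev, map_mul]
        calc y⁻¹ * x⁻¹ * (h x * h y) = y⁻¹ * (x⁻¹ * h x) * h y := by group
          _ = x⁻¹ * h x * (y⁻¹ * h y) := by rw [this]; group }
  have hd : commutator G ≤ d.ker := by
    rw [commutator_def, Subgroup.commutator_le]
    intro a _ b _
    rw [MonoidHom.mem_ker, map_commutatorElement, commutatorElement_eq_one_iff_mul_comm]
    apply Subtype.ext
    exact hZ _ (d b).2 _
  have hfix : ∀ z, π z = 1 → h z = z := fun z hz => by
    have h1 : d z = 1 := hd (hC hz)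
    have h2 : z⁻¹ * h z = 1 := congrArg Subtype.val h1
    exact (inv_mul_eq_one.mp h2).symm
  constructor
  · rw [injective_iff_map_eq_one]
    intro x hx
    have : π x = 1 := by rw [← hh, hx, map_one]
    rw [← hfix x this, hx]
  · intro x
    refine ⟨x * (x⁻¹ * h x)⁻¹, ?_⟩
    rw [map_mul, map_inv, hfix _ (key x)]
    group

/-- Endomorphisms of the quotient by a term of the lower central series of the free group
lift to the next quotient. -/
theorem exists_lift_free {α : Type*} (m k : ℕ)
    (π : (FreeGroup α ⧸ Subgroup.lowerCentralSeries (⊤ : Subgroup (FreeGroup α)) m) →*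
      (FreeGroup α ⧸ Subgroup.lowerCentralSeries (⊤ : Subgroup (FreeGroup α)) k))
    (hπ : ∀ g : FreeGroup α, π (QuotientGroup.mk g) = QuotientGroup.mk g)
    (φ : (FreeGroup α ⧸ Subgroup.lowerCentralSeries (⊤ : Subgroup (FreeGroup α)) k) →*
      (FreeGroup α ⧸ Subgroup.lowerCentralSeries (⊤ : Subgroup (FreeGroup α)) k)) :
    ∃ f : (FreeGroup α ⧸ Subgroup.lowerCentralSeries (⊤ : Subgroup (FreeGroup α)) m) →*
      (FreeGroup α ⧸ Subgroup.lowerCentralSeries (⊤ : Subgroup (FreeGroup α)) m),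
      ∀ x, π (f x) = φ (π x) := by
  choose s hs using fun a : α => QuotientGroup.mk_surjective
    (φ (QuotientGroup.mk (FreeGroup.of a)))
  let F : FreeGroup α →* FreeGroup α := FreeGroup.lift s
  have hF : (⊤ : Subgroup (FreeGroup α)).lowerCentralSeries m ≤
      ((⊤ : Subgroup (FreeGroup α)).lowerCentralSeries m).comap F := by
    rw [← Subgroup.map_le_iff_le_comap, Subgroup.map_lowerCentralSeries]
    exact Subgroup.lowerCentralSeries_mono m le_top
  refine ⟨QuotientGroup.map _ _ F hF, ?_⟩
  intro x
  obtain ⟨g, rfl⟩ := QuotientGroup.mk_surjective x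
  rw [QuotientGroup.map_mk, hπ, hπ]
  have : (QuotientGroup.mk' ((⊤ : Subgroup (FreeGroup α)).lowerCentralSeries k)).comp F =
      φ.comp (QuotientGroup.mk' _) := by
    ext a
    simpa [F] using hs a
  exact DFunLike.congr_fun this g


/-- Every automorphism of the free `(c-1)`-step nilpotent quotient `F_n/Γ_c(F_n)` lifts
to an automorphism of `F_n/Γ_{c+1}(F_n)` along the canonical projection `π`
(characterized by `π(g Γ_{c+1}) = g Γ_c`); i.e. the canonical map
`Aut(F_n/Γ_{c+1}(F_n)) → Aut(F_n/Γ_c(F_n))` is surjective.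
(Recall `Γ_i(F_n) = lowerCentralSeries F_n (i-1)`.) -/
theorem aut_free_nilpotent_surjective (n c : ℕ) (hn : 1 ≤ n) (hc : 1 ≤ c)
    (π : (FreeGroup (Fin n) ⧸ Subgroup.lowerCentralSeries (⊤ : Subgroup (FreeGroup (Fin n))) c) →*
      (FreeGroup (Fin n) ⧸ Subgroup.lowerCentralSeries (⊤ : Subgroup (FreeGroup (Fin n))) (c - 1)))
    (hπ : ∀ g : FreeGroup (Fin n), π (QuotientGroup.mk g) = QuotientGroup.mk g)
    (φ : MulAut (FreeGroup (Fin n) ⧸ Subgroup.lowerCentralSeries (⊤ : Subgroup (FreeGroup (Fin n))) (c - 1))) :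
    ∃ ψ : MulAut (FreeGroup (Fin n) ⧸ Subgroup.lowerCentralSeries (⊤ : Subgroup (FreeGroup (Fin n))) c),
      ∀ x, π (ψ x) = φ (π x) := by
  obtain rfl | ⟨k, rfl⟩ : c = 1 ∨ ∃ k, c = k + 2 := by
    rcases c with _ | _ | k
    · omega
    · exact Or.inl rfl
    · exact Or.inr ⟨k, rfl⟩
  · refine ⟨1, fun x => ?_⟩
    obtain ⟨a, ha⟩ := QuotientGroup.mk_surjective (π ((1 : MulAut _) x))
    obtain ⟨b, hb⟩ := QuotientGroup.mk_surjective (φ (π x))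
    rw [← ha, ← hb, QuotientGroup.eq]
    exact Subgroup.mem_top _
  · obtain ⟨f, hf⟩ := exists_lift_free _ _ π hπ φ.toMonoidHom
    obtain ⟨g, hg⟩ := exists_lift_free _ _ π hπ φ.symm.toMonoidHom
    have hker : ∀ a : FreeGroup (Fin n), π (QuotientGroup.mk a) = 1 →
        a ∈ (⊤ : Subgroup (FreeGroup (Fin n))).lowerCentralSeries (k + 1) := by
      intro a ha
      rw [hπ] at ha
      exact (QuotientGroup.eq_one_iff a).mp ha
    have hZ : ∀ z, π z = 1 → ∀ x, x * z = z * x := by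
      intro z hz x
      obtain ⟨a, rfl⟩ := QuotientGroup.mk_surjective z
      obtain ⟨b, rfl⟩ := QuotientGroup.mk_surjective x
      have hm : a * b * a⁻¹ * b⁻¹ ∈ (⊤ : Subgroup (FreeGroup (Fin n))).lowerCentralSeries (k + 2) := by
        rw [Subgroup.lowerCentralSeries_succ]
        exact Subgroup.subset_closure ⟨a, hker a hz, b, Subgroup.mem_top b, rfl⟩
      have h1 := (QuotientGroup.eq_one_iff _).mpr hm
      symm
      rw [← commutatorElement_eq_one_iff_mul_comm]
      exact h1
    have hC : π.ker ≤ commutator _ := by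
      intro z hz
      obtain ⟨a, rfl⟩ := QuotientGroup.mk_surjective z
      have ha := hker a hz
      have ha1 : a ∈ commutator (FreeGroup (Fin n)) := by
        rw [← Subgroup.top_lowerCentralSeries_one]
        exact Subgroup.lowerCentralSeries_antitone _ (by omega) ha
      have := Subgroup.mem_map_of_mem (QuotientGroup.mk'
        ((⊤ : Subgroup (FreeGroup (Fin n))).lowerCentralSeries (k + 2))) ha1
      rw [commutator_def, Subgroup.map_commutator] at this
      exact Subgroup.commutator_mono le_top le_top this
    have b1 := bijective_of_central_lift π hZ hC (g.comp f) (fun x => by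
      exact (hg _).trans ((congrArg φ.symm (hf x)).trans (φ.symm_apply_apply _)))
    have b2 := bijective_of_central_lift π hZ hC (f.comp g) (fun x => by
      exact (hf _).trans ((congrArg φ (hg x)).trans (φ.apply_symm_apply _)))
    have hb : Function.Bijective f :=
      ⟨Function.Injective.of_comp (f := g) b1.1, Function.Surjective.of_comp (g := g) b2.2⟩
    exact ⟨MulEquiv.ofBijective f hb, fun x => hf x⟩
end
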